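/- arXiv:0712.1378 — 2 statements merged into one kernel-verified Lean document; each statement's English description precedes it below -/
import Mathlib

section
/- For λ > 0 define F_λ(t) = (1/2) ∫_{(√t−√λ)²}^{(√t+√λ)²} log x · √(4λt − (x − t − λ)²)/(2πx) dx. Then F_λ is differentiable at every t with 0 < t < λ, and its derivative there equals (1/2)·log(λ − t). -/
open Real MeasureTheory

open InnerProductSpace in
theorem InnerProductSpace.HarmonicOnNhd.integral_poissonKernel_mul {f : ℂ → ℝ} {w : ℂ}
    (hf : HarmonicOnNhd f (Metric.closedBall 0 1)) (hw : w ∈ Metric.ball (0 : ℂ) 1) :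
    ∫ θ in (0 : ℝ)..2 * π, poissonKernel 0 w (circleMap 0 1 θ) * f (circleMap 0 1 θ) =
      2 * π * f w := by
  have h := hf.circleAverage_poissonKernel_smul hw
  rw [circleAverage_def, smul_eq_mul, inv_mul_eq_iff_eq_mul₀ (by positivity)] at h
  simpa using h

theorem Real.integral_comp_cos_two_pi {f : ℝ → ℝ} (hf : Continuous fun θ => f (cos θ)) :
    ∫ θ in (0 : ℝ)..2 * π, f (cos θ) = 2 * ∫ θ in (0 : ℝ)..π, f (cos θ) := by
  have h : ∫ θ in π..2 * π, f (cos θ) = ∫ θ in (0 : ℝ)..π, f (cos θ) := by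
    have := intervalIntegral.integral_comp_sub_left (fun θ => f (cos θ)) (2 * π)
      (a := 0) (b := π)
    simp only [cos_two_pi_sub, sub_zero] at this
    rw [this]
    congr 1
    ring
  rw [← intervalIntegral.integral_add_adjacent_intervals (hf.intervalIntegrable 0 π)
    (hf.intervalIntegrable π (2 * π)), h, two_mul]

/-- The squared distance `‖a - b * exp (θ * I)‖ ^ 2`. -/
noncomputable def lawOfCosines (a b θ : ℝ) : ℝ := a ^ 2 + b ^ 2 - 2 * a * b * cos θ

section LawOfCosines

variable {a b : ℝ}

@[fun_prop]
theorem continuous_lawOfCosines : Continuous (lawOfCosines a b) := by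
  unfold lawOfCosines
  fun_prop

theorem lawOfCosines_pos (hb : 0 < b) (hab : b < a) (θ : ℝ) : 0 < lawOfCosines a b θ := by
  have ha : 0 < a := hb.trans hab
  have := mul_le_mul_of_nonneg_left (cos_le_one θ) (by positivity : 0 ≤ 2 * a * b)
  have := pow_pos (sub_pos.2 hab) 2
  unfold lawOfCosines
  linarith

theorem continuous_log_lawOfCosines (hb : 0 < b) (hab : b < a) :
    Continuous fun θ => log (lawOfCosines a b θ) :=
  continuous_lawOfCosines.log fun θ => (lawOfCosines_pos hb hab θ).ne'

theorem continuous_inv_lawOfCosines (hb : 0 < b) (hab : b < a) :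
    Continuous fun θ => (lawOfCosines a b θ)⁻¹ :=
  continuous_lawOfCosines.inv₀ fun θ => (lawOfCosines_pos hb hab θ).ne'

theorem norm_sub_mul_circleMap_sq (a b θ : ℝ) :
    ‖(a : ℂ) - b * circleMap 0 1 θ‖ ^ 2 = lawOfCosines a b θ := by
  rw [← Complex.normSq_eq_norm_sq, Complex.normSq_apply, lawOfCosines]
  simp [circleMap, Complex.exp_ofReal_mul_I_re, Complex.exp_ofReal_mul_I_im]
  linear_combination b ^ 2 * sin_sq_add_cos_sq θ

theorem poissonKernel_div_circleMap (hb : 0 < b) (hab : b < a) (θ : ℝ) :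
    poissonKernel 0 ((b / a : ℝ) : ℂ) (circleMap 0 1 θ) =
      (a ^ 2 - b ^ 2) * (lawOfCosines a b θ)⁻¹ := by
  have ha : 0 < a := hb.trans hab
  have h : ‖circleMap 0 1 θ - ((b / a : ℝ) : ℂ)‖ ^ 2 = lawOfCosines a b θ / a ^ 2 := by
    rw [← Complex.normSq_eq_norm_sq, Complex.normSq_apply, lawOfCosines]
    simp [circleMap, Complex.exp_ofReal_mul_I_re, Complex.exp_ofReal_mul_I_im,
      -Complex.ofReal_div]
    field_simp
    linear_combination a ^ 2 * sin_sq_add_cos_sq θ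
  have hx := (lawOfCosines_pos hb hab θ).ne'
  rw [poissonKernel_def, sub_zero, sub_zero, h, norm_circleMap_zero, Complex.norm_real,
    norm_eq_abs, sq_abs, sq_abs]
  field_simp

theorem div_mem_unit_ball (hb : 0 < b) (hab : b < a) :
    ((b / a : ℝ) : ℂ) ∈ Metric.ball (0 : ℂ) 1 := by
  have ha : 0 < a := hb.trans hab
  rw [mem_ball_zero_iff, Complex.norm_real, norm_eq_abs, abs_of_pos (by positivity),
    div_lt_one ha]
  exact hab

theorem harmonicOnNhd_log_norm_sub_mul (hb : 0 < b) (hab : b < a) :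
    InnerProductSpace.HarmonicOnNhd (fun z : ℂ => log ‖(a : ℂ) - b * z‖)
      (Metric.closedBall 0 1) := by
  intro z hz
  refine AnalyticAt.harmonicAt_log_norm (f := fun z : ℂ => (a : ℂ) - b * z) (by fun_prop) ?_
  intro h
  have hn := congrArg norm (sub_eq_zero.1 h)
  rw [norm_mul, Complex.norm_real, Complex.norm_real, norm_eq_abs, norm_eq_abs, abs_of_pos hb,
    abs_of_pos (hb.trans hab)] at hn
  have := mul_le_mul_of_nonneg_left (mem_closedBall_zero_iff.1 hz) hb.le
  linarith

theorem log_norm_sub_mul_circleMap (a b θ : ℝ) :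
    log ‖(a : ℂ) - b * circleMap 0 1 θ‖ = log (lawOfCosines a b θ) / 2 := by
  rw [← norm_sub_mul_circleMap_sq, log_pow]
  push_cast
  ring

theorem integral_inv_lawOfCosines (hb : 0 < b) (hab : b < a) :
    (a ^ 2 - b ^ 2) * ∫ θ in (0 : ℝ)..π, (lawOfCosines a b θ)⁻¹ = π := by
  have h := (InnerProductSpace.harmonicOnNhd_const (1 : ℝ)
    (s := Metric.closedBall (0 : ℂ) 1)).integral_poissonKernel_mul (div_mem_unit_ball hb hab)
  simp only [poissonKernel_div_circleMap hb hab, mul_one,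
    intervalIntegral.integral_const_mul] at h
  have h2 := integral_comp_cos_two_pi (f := fun c => (a ^ 2 + b ^ 2 - 2 * a * b * c)⁻¹)
    (continuous_inv_lawOfCosines hb hab)
  unfold lawOfCosines at h ⊢
  rw [h2] at h
  linarith

theorem integral_log_mul_inv_lawOfCosines (hb : 0 < b) (hab : b < a) :
    (a ^ 2 - b ^ 2) * ∫ θ in (0 : ℝ)..π, log (lawOfCosines a b θ) * (lawOfCosines a b θ)⁻¹ =
      2 * π * (log (a ^ 2 - b ^ 2) - log a) := by
  have ha : 0 < a := hb.trans hab
  have hd : 0 < a ^ 2 - b ^ 2 := by nlinarith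
  have h := (harmonicOnNhd_log_norm_sub_mul hb hab).integral_poissonKernel_mul
    (div_mem_unit_ball hb hab)
  have hw : log ‖(a : ℂ) - b * ((b / a : ℝ) : ℂ)‖ = log (a ^ 2 - b ^ 2) - log a := by
    have e : (a : ℂ) - b * ((b / a : ℝ) : ℂ) = (((a ^ 2 - b ^ 2) / a : ℝ) : ℂ) := by
      have : a - b * (b / a) = (a ^ 2 - b ^ 2) / a := by field_simp
      exact_mod_cast this
    rw [e, Complex.norm_real, norm_eq_abs, log_abs, log_div hd.ne' ha.ne']
  have hk (θ : ℝ) : (a ^ 2 - b ^ 2) * (lawOfCosines a b θ)⁻¹ * (log (lawOfCosines a b θ) / 2) =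
      (a ^ 2 - b ^ 2) / 2 * (log (lawOfCosines a b θ) * (lawOfCosines a b θ)⁻¹) := by ring
  simp only [poissonKernel_div_circleMap hb hab, log_norm_sub_mul_circleMap, hw, hk,
    intervalIntegral.integral_const_mul] at h
  have h2 := integral_comp_cos_two_pi
    (f := fun c => log (a ^ 2 + b ^ 2 - 2 * a * b * c) * (a ^ 2 + b ^ 2 - 2 * a * b * c)⁻¹)
    ((continuous_log_lawOfCosines hb hab).mul (continuous_inv_lawOfCosines hb hab))
  unfold lawOfCosines at h ⊢
  rw [h2] at h
  linarith

theorem integral_log_lawOfCosines (hb : 0 < b) (hab : b < a) :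
    ∫ θ in (0 : ℝ)..π, log (lawOfCosines a b θ) = 2 * π * log a := by
  have h := (harmonicOnNhd_log_norm_sub_mul hb hab).integral_poissonKernel_mul
    (Metric.mem_ball_self one_pos)
  simp only [poissonKernel_def, sub_zero, norm_circleMap_zero, log_norm_sub_mul_circleMap,
    norm_zero, mul_zero, Complex.norm_real, norm_eq_abs, log_abs, abs_one] at h
  norm_num at h
  have h2 := integral_comp_cos_two_pi
    (f := fun c => log (a ^ 2 + b ^ 2 - 2 * a * b * c)) (continuous_log_lawOfCosines hb hab)
  unfold lawOfCosines at h ⊢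
  rw [h2] at h
  linarith

theorem sin_sq_mul_inv_lawOfCosines (hb : 0 < b) (hab : b < a) (θ : ℝ) :
    (2 * a * b * sin θ) ^ 2 * (lawOfCosines a b θ)⁻¹ =
      (a ^ 2 + b ^ 2) + 2 * a * b * cos θ -
        (a ^ 2 - b ^ 2) ^ 2 * (lawOfCosines a b θ)⁻¹ := by
  have hx := (lawOfCosines_pos hb hab θ).ne'
  field_simp
  unfold lawOfCosines
  linear_combination 4 * a ^ 2 * b ^ 2 * sin_sq_add_cos_sq θ

theorem integral_sin_sq_mul_inv_lawOfCosines (hb : 0 < b) (hab : b < a) :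
    ∫ θ in (0 : ℝ)..π, (2 * a * b * sin θ) ^ 2 * (lawOfCosines a b θ)⁻¹ = 2 * π * b ^ 2 := by
  have hc := continuous_inv_lawOfCosines hb hab
  simp only [sin_sq_mul_inv_lawOfCosines hb hab]
  rw [intervalIntegral.integral_sub (Continuous.intervalIntegrable (by fun_prop) _ _)
      (Continuous.intervalIntegrable (by fun_prop) _ _),
    intervalIntegral.integral_add (Continuous.intervalIntegrable (by fun_prop) _ _)
      (Continuous.intervalIntegrable (by fun_prop) _ _)]
  simp only [intervalIntegral.integral_const_mul, intervalIntegral.integral_const, integral_cos,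
    sin_pi, sin_zero, smul_eq_mul]
  linear_combination (-(a ^ 2 - b ^ 2)) * integral_inv_lawOfCosines hb hab

theorem hasDerivAt_lawOfCosines (a b θ : ℝ) :
    HasDerivAt (lawOfCosines a b) (2 * a * b * sin θ) θ :=
  (((hasDerivAt_cos θ).const_mul (2 * a * b)).const_sub (a ^ 2 + b ^ 2)).congr_deriv (by ring)

theorem integral_log_lawOfCosines_mul_cos (hb : 0 < b) (hab : b < a) :
    2 * a * b * ∫ θ in (0 : ℝ)..π, log (lawOfCosines a b θ) * cos θ = -(2 * π * b ^ 2) := by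
  have hc := continuous_inv_lawOfCosines hb hab
  have h := intervalIntegral.integral_mul_deriv_eq_deriv_mul
    (u := fun θ => log (lawOfCosines a b θ)) (v := sin) (a := 0) (b := π)
    (u' := fun θ => 2 * a * b * sin θ * (lawOfCosines a b θ)⁻¹) (v' := cos)
    (fun θ _ => (hasDerivAt_lawOfCosines a b θ).log (lawOfCosines_pos hb hab θ).ne')
    (fun θ _ => hasDerivAt_sin θ)
    (Continuous.intervalIntegrable (by fun_prop) _ _)
    (Continuous.intervalIntegrable (by fun_prop) _ _)
  rw [h, ← integral_sin_sq_mul_inv_lawOfCosines hb hab]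
  simp only [sin_pi, sin_zero, mul_zero, sub_zero, zero_sub, mul_neg, neg_inj]
  rw [← intervalIntegral.integral_const_mul]
  congr 1 with θ
  ring

theorem integral_log_mul_sin_sq_mul_inv_lawOfCosines (hb : 0 < b) (hab : b < a) :
    ∫ θ in (0 : ℝ)..π, log (lawOfCosines a b θ) *
        ((2 * a * b * sin θ) ^ 2 * (lawOfCosines a b θ)⁻¹) =
      2 * π * (2 * a ^ 2 * log a - (a ^ 2 - b ^ 2) * log (a ^ 2 - b ^ 2) - b ^ 2) := by
  have hi := continuous_inv_lawOfCosines hb hab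
  have hl := continuous_log_lawOfCosines hb hab
  have hk (θ : ℝ) : log (lawOfCosines a b θ) *
        ((2 * a * b * sin θ) ^ 2 * (lawOfCosines a b θ)⁻¹) =
      (a ^ 2 + b ^ 2) * log (lawOfCosines a b θ) +
        2 * a * b * (log (lawOfCosines a b θ) * cos θ) -
        (a ^ 2 - b ^ 2) ^ 2 * (log (lawOfCosines a b θ) * (lawOfCosines a b θ)⁻¹) := by
    rw [sin_sq_mul_inv_lawOfCosines hb hab]
    ring
  simp only [hk]
  rw [intervalIntegral.integral_sub (Continuous.intervalIntegrable (by fun_prop) _ _)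
      (Continuous.intervalIntegrable (by fun_prop) _ _),
    intervalIntegral.integral_add (Continuous.intervalIntegrable (by fun_prop) _ _)
      (Continuous.intervalIntegrable (by fun_prop) _ _)]
  simp only [intervalIntegral.integral_const_mul]
  linear_combination (a ^ 2 + b ^ 2) * integral_log_lawOfCosines hb hab +
    integral_log_lawOfCosines_mul_cos hb hab -
    (a ^ 2 - b ^ 2) * integral_log_mul_inv_lawOfCosines hb hab

theorem integral_log_mul_marchenkoPastur (hb : 0 < b) (hab : b < a) :
    ∫ x in (b - a) ^ 2..(b + a) ^ 2,
        log x * √(4 * a ^ 2 * b ^ 2 - (x - b ^ 2 - a ^ 2) ^ 2) / (2 * π * x) =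
      2 * a ^ 2 * log a - (a ^ 2 - b ^ 2) * log (a ^ 2 - b ^ 2) - b ^ 2 := by
  have ha : 0 < a := hb.trans hab
  have h := intervalIntegral.integral_comp_mul_deriv' (a := 0) (b := π)
    (f := lawOfCosines a b) (f' := fun θ => 2 * a * b * sin θ)
    (g := fun x => log x * √(4 * a ^ 2 * b ^ 2 - (x - b ^ 2 - a ^ 2) ^ 2) / (2 * π * x))
    (fun θ _ => hasDerivAt_lawOfCosines a b θ) (by fun_prop) (by
      rintro _ ⟨θ, -, rfl⟩
      have hx := lawOfCosines_pos hb hab θ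
      have : 2 * π * lawOfCosines a b θ ≠ 0 := by positivity
      have := hx.ne'
      apply ContinuousAt.continuousWithinAt
      fun_prop (disch := assumption))
  have e0 : lawOfCosines a b 0 = (b - a) ^ 2 := by
    rw [lawOfCosines, cos_zero]
    ring
  have e1 : lawOfCosines a b π = (b + a) ^ 2 := by
    rw [lawOfCosines, cos_pi]
    ring
  rw [e0, e1] at h
  rw [← h]
  trans ∫ θ in (0 : ℝ)..π, (2 * π)⁻¹ * (log (lawOfCosines a b θ) *
      ((2 * a * b * sin θ) ^ 2 * (lawOfCosines a b θ)⁻¹))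
  · refine intervalIntegral.integral_congr fun θ hθ => ?_
    rw [Set.uIcc_of_le pi_pos.le] at hθ
    have hs : 0 ≤ 2 * a * b * sin θ :=
      mul_nonneg (by positivity) (sin_nonneg_of_mem_Icc hθ)
    have hr : 4 * a ^ 2 * b ^ 2 - (lawOfCosines a b θ - b ^ 2 - a ^ 2) ^ 2 =
        (2 * a * b * sin θ) ^ 2 := by
      unfold lawOfCosines
      linear_combination (-4) * a ^ 2 * b ^ 2 * sin_sq_add_cos_sq θ
    simp only [Function.comp_apply, hr, sqrt_sq hs]
    have hx := (lawOfCosines_pos hb hab θ).ne'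
    field_simp
  · rw [intervalIntegral.integral_const_mul,
      integral_log_mul_sin_sq_mul_inv_lawOfCosines hb hab]
    field_simp

end LawOfCosines

/-- For `l > 0`, the function
`F_l(t) = (1/2) ∫_{(√t−√l)²}^{(√t+√l)²} log x · √(4lt − (x − t − l)²)/(2πx) dx`
is differentiable at every `t` with `0 < t < l`, with derivative `(1/2)·log(l − t)`. -/
theorem stmt1 (l : ℝ) (hl : 0 < l) (t : ℝ) (ht : 0 < t) (htl : t < l) :
    HasDerivAt
      (fun s : ℝ =>
        (1 / 2) *
          ∫ x in ((Real.sqrt s - Real.sqrt l) ^ 2)..((Real.sqrt s + Real.sqrt l) ^ 2),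
            Real.log x * Real.sqrt (4 * l * s - (x - s - l) ^ 2) / (2 * π * x))
      ((1 / 2) * Real.log (l - t)) t := by
  have hd : HasDerivAt
      (fun s => (1 / 2) * (2 * l * log √l - (l - s) * log (l - s) - s))
      ((1 / 2) * log (l - t)) t := by
    have h1 : HasDerivAt (fun s : ℝ => l - s) (-1) t := (hasDerivAt_id t).const_sub l
    have h2 := h1.log (sub_pos.2 htl).ne'
    refine ((((h1.mul h2).const_sub (2 * l * log √l)).sub
      (hasDerivAt_id t)).const_mul (1 / 2)).congr_deriv ?_
    have := (sub_pos.2 htl).ne'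
    field_simp
    ring
  refine hd.congr_of_eventuallyEq ?_
  filter_upwards [Ioo_mem_nhds ht htl] with s hs
  have h := integral_log_mul_marchenkoPastur (sqrt_pos.2 hs.1) (sqrt_lt_sqrt hs.1.le hs.2)
  rw [sq_sqrt hl.le, sq_sqrt hs.1.le] at h
  rw [h]
end

section
/- For every real λ ≥ 1, ∫_{(1−√λ)²}^{(1+√λ)²} log x · √(4λ − (x−1−λ)²)/(2πx) dx = λ·log λ − (λ−1)·log(λ−1) − 1, with the convention that (λ−1)·log(λ−1) = 0 when λ = 1; in particular, for λ = 1 the integral equals −1. -/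
open Real MeasureTheory

/-- The squared distance `‖e^{iθ} + s‖²`, as a function of the angle `θ`. -/
noncomputable def sqDist (s θ : ℝ) : ℝ := 1 + s ^ 2 + 2 * s * cos θ

lemma continuous_sqDist (s : ℝ) : Continuous (sqDist s) := by
  unfold sqDist; fun_prop

lemma norm_circleMap_sub_neg_sq (s θ : ℝ) :
    ‖circleMap 0 1 θ - (-(s : ℂ))‖ ^ 2 = sqDist s θ := by
  rw [← Complex.normSq_eq_norm_sq, circleMap_zero, Complex.exp_mul_I, Complex.normSq_apply]
  simp [Complex.cos_ofReal_re, Complex.sin_ofReal_re, Complex.cos_ofReal_im,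
    Complex.sin_ofReal_im, sqDist]
  linarith [sin_sq_add_cos_sq θ, sq_nonneg (cos θ)]

lemma log_norm_circleMap_sub_neg (s θ : ℝ) :
    log ‖circleMap 0 1 θ - (-(s : ℂ))‖ = log (sqDist s θ) / 2 := by
  rw [← norm_circleMap_sub_neg_sq, log_pow]
  push_cast
  ring

lemma sqDist_pos_of_one_lt {s : ℝ} (hs : 1 < s) (θ : ℝ) : 0 < sqDist s θ := by
  unfold sqDist
  nlinarith [neg_one_le_cos θ]

lemma sqDist_pos_of_mem_Ioo {s θ : ℝ} (hs : 1 ≤ s) (hθ : θ ∈ Set.Ioo 0 π) : 0 < sqDist s θ := by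
  have h : -1 < cos θ := by
    rw [← cos_pi]
    exact strictAntiOn_cos ⟨hθ.1.le, hθ.2.le⟩ ⟨pi_pos.le, le_rfl⟩ hθ.2
  unfold sqDist
  nlinarith

lemma integral_zero_pi_eq_half {f : ℝ → ℝ} (hf : IntervalIntegrable f volume 0 (2 * π))
    (hsymm : ∀ θ, f (2 * π - θ) = f θ) :
    ∫ θ in 0..π, f θ = (∫ θ in 0..2 * π, f θ) / 2 := by
  have hπ := pi_pos
  have h₁ : IntervalIntegrable f volume 0 π :=
    hf.mono_set (by
      rw [Set.uIcc_of_le hπ.le, Set.uIcc_of_le (by linarith)]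
      exact Set.Icc_subset_Icc le_rfl (by linarith))
  have h₂ : IntervalIntegrable f volume π (2 * π) :=
    hf.mono_set (by
      rw [Set.uIcc_of_le (by linarith), Set.uIcc_of_le (by linarith)]
      exact Set.Icc_subset_Icc hπ.le le_rfl)
  have h₃ : ∫ θ in π..2 * π, f θ = ∫ θ in 0..π, f θ := by
    have := intervalIntegral.integral_comp_sub_left f (2 * π) (a := 0) (b := π)
    simp only [hsymm, sub_zero] at this
    rw [this]
    congr 1
    ring
  rw [← intervalIntegral.integral_add_adjacent_intervals h₁ h₂, h₃]
  ring

lemma sqDist_two_pi_sub (s θ : ℝ) : sqDist s (2 * π - θ) = sqDist s θ := by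
  simp [sqDist, cos_two_pi_sub]

lemma intervalIntegrable_log_sqDist (s : ℝ) :
    IntervalIntegrable (fun θ ↦ log (sqDist s θ)) volume 0 (2 * π) := by
  have h := (circleIntegrable_log_norm_sub_const (a := -(s : ℂ)) (c := 0) 1).const_mul 2
  refine h.congr fun θ _ ↦ ?_
  simp only [log_norm_circleMap_sub_neg]
  ring

lemma intervalIntegrable_log_sqDist_zero_pi (s : ℝ) :
    IntervalIntegrable (fun θ ↦ log (sqDist s θ)) volume 0 π :=
  (intervalIntegrable_log_sqDist s).mono_set (by
    have hπ := pi_pos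
    rw [Set.uIcc_of_le hπ.le, Set.uIcc_of_le (by linarith)]
    exact Set.Icc_subset_Icc le_rfl (by linarith))

lemma integral_log_sqDist {s : ℝ} (hs : 1 ≤ s) :
    ∫ θ in 0..π, log (sqDist s θ) = 2 * π * log s := by
  have h := circleAverage_log_norm_sub_const_eq_posLog (a := -(s : ℂ))
  have hn : ‖(-(s : ℂ))‖ = s := by simp [abs_of_pos (by linarith : 0 < s)]
  rw [hn, posLog_eq_log (by rw [abs_of_pos] <;> linarith), circleAverage_def] at h
  simp only [log_norm_circleMap_sub_neg, smul_eq_mul, intervalIntegral.integral_div] at h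
  rw [integral_zero_pi_eq_half (intervalIntegrable_log_sqDist s)
    (by simp [sqDist_two_pi_sub]), ← h]
  field_simp

lemma continuous_div_sqDist {s : ℝ} (hs : 1 ≤ s) :
    Continuous (fun θ ↦ (s ^ 2 - 1) ^ 2 / sqDist s θ) := by
  rcases hs.eq_or_lt with rfl | hs
  · simpa using continuous_const
  · exact continuous_const.div (continuous_sqDist s) fun θ ↦ (sqDist_pos_of_one_lt hs θ).ne'

lemma continuous_log_mul_div_sqDist {s : ℝ} (hs : 1 ≤ s) :
    Continuous (fun θ ↦ log (sqDist s θ) * ((s ^ 2 - 1) ^ 2 / sqDist s θ)) := by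
  rcases hs.eq_or_lt with rfl | hs'
  · simpa using continuous_const
  · exact ((continuous_sqDist s).log fun θ ↦ (sqDist_pos_of_one_lt hs' θ).ne').mul
      (continuous_div_sqDist hs)

lemma poissonKernel_circleMap {s : ℝ} (hs : 1 < s) (θ : ℝ) :
    poissonKernel 0 (-((s⁻¹ : ℝ) : ℂ)) (circleMap 0 1 θ) = (s ^ 2 - 1) / sqDist s θ := by
  have h : sqDist s⁻¹ θ = sqDist s θ / s ^ 2 := by
    unfold sqDist
    field_simp
    ring
  have := sqDist_pos_of_one_lt hs θ
  rw [poissonKernel_def]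
  simp only [sub_zero]
  rw [norm_circleMap_sub_neg_sq, h, norm_circleMap_zero, norm_neg, Complex.norm_real, norm_eq_abs]
  simp only [sq_abs, one_pow]
  field_simp

lemma integral_mul_div_sqDist {s : ℝ} (hs : 1 < s) {f : ℂ → ℝ}
    (hf : InnerProductSpace.HarmonicOnNhd f (Metric.closedBall 0 1)) :
    ∫ θ in 0..2 * π, f (circleMap 0 1 θ) * ((s ^ 2 - 1) ^ 2 / sqDist s θ)
      = 2 * π * (s ^ 2 - 1) * f (-((s⁻¹ : ℝ) : ℂ)) := by
  have hw : -((s⁻¹ : ℝ) : ℂ) ∈ Metric.ball (0 : ℂ) 1 := by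
    rw [mem_ball_zero_iff, norm_neg, Complex.norm_real, norm_eq_abs, abs_of_pos (by positivity)]
    exact inv_lt_one_of_one_lt₀ hs
  rw [← InnerProductSpace.HarmonicOnNhd.circleAverage_poissonKernel_smul hf hw, circleAverage_def]
  simp only [Pi.smul_apply', poissonKernel_circleMap hs, smul_eq_mul]
  rw [← mul_assoc, mul_right_comm (2 * π), mul_inv_cancel₀ (by positivity), one_mul,
    ← intervalIntegral.integral_const_mul]
  congr with θ
  ring

lemma integral_div_sqDist {s : ℝ} (hs : 1 ≤ s) :
    ∫ θ in 0..π, (s ^ 2 - 1) ^ 2 / sqDist s θ = π * (s ^ 2 - 1) := by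
  rcases hs.eq_or_lt with rfl | hs'
  · simp
  have h := integral_mul_div_sqDist hs' (f := fun _ ↦ 1)
    (fun z _ ↦ InnerProductSpace.harmonicAt_const 1)
  simp only [one_mul] at h
  rw [integral_zero_pi_eq_half ((continuous_div_sqDist hs).intervalIntegrable _ _)
    (by simp [sqDist_two_pi_sub]), h]
  ring

lemma integral_log_mul_div_sqDist {s : ℝ} (hs : 1 ≤ s) :
    ∫ θ in 0..π, log (sqDist s θ) * ((s ^ 2 - 1) ^ 2 / sqDist s θ)
      = 2 * π * (s ^ 2 - 1) * (log (s ^ 2 - 1) - log s) := by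
  rcases hs.eq_or_lt with rfl | hs'
  · simp
  have h := integral_mul_div_sqDist hs' (f := fun z ↦ log ‖z - (-(s : ℂ))‖) (fun z hz ↦ by
    apply AnalyticAt.harmonicAt_log_norm (by fun_prop)
    rw [sub_ne_zero]
    rintro rfl
    rw [mem_closedBall_zero_iff, norm_neg, Complex.norm_real, norm_eq_abs,
      abs_of_pos (by linarith)] at hz
    linarith)
  have hv : ‖-((s⁻¹ : ℝ) : ℂ) - (-(s : ℂ))‖ = (s ^ 2 - 1) / s := by
    have : -((s⁻¹ : ℝ) : ℂ) - (-(s : ℂ)) = (((s ^ 2 - 1) / s : ℝ) : ℂ) := by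
      rw [← Complex.ofReal_neg, ← Complex.ofReal_neg, ← Complex.ofReal_sub]
      congr 1
      field_simp
      ring
    rw [this, Complex.norm_real, norm_eq_abs, abs_of_pos]
    exact div_pos (by nlinarith) (by linarith)
  simp only [log_norm_circleMap_sub_neg, hv, div_mul_eq_mul_div _ (2 : ℝ),
    intervalIntegral.integral_div] at h
  rw [log_div (by nlinarith) (by linarith)] at h
  rw [integral_zero_pi_eq_half ((continuous_log_mul_div_sqDist hs).intervalIntegrable _ _)
    (by simp [sqDist_two_pi_sub]), h]

lemma continuous_sin_mul_log_sqDist {s : ℝ} (hs : 1 ≤ s) :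
    Continuous (fun θ ↦ sin θ * log (sqDist s θ)) := by
  rcases hs.eq_or_lt with rfl | hs
  · have h (θ : ℝ) : sin θ * log (sqDist 1 θ)
        = sin θ * log 4 + 4 * sin (θ / 2) * (cos (θ / 2) * log (cos (θ / 2))) := by
      have hsin : sin θ = 2 * sin (θ / 2) * cos (θ / 2) := by
        rw [← sin_two_mul]; ring_nf
      have hcos : cos θ = 2 * cos (θ / 2) ^ 2 - 1 := by
        rw [← cos_two_mul]; ring_nf
      by_cases h₀ : cos (θ / 2) = 0
      · simp [hsin, h₀]
      · have : sqDist 1 θ = 4 * cos (θ / 2) ^ 2 := by rw [sqDist, hcos]; ring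
        rw [this, log_mul (by norm_num) (by positivity), log_pow, hsin]
        push_cast
        ring
    simp only [h]
    have := continuous_mul_log.comp (continuous_cos.comp (continuous_id.div_const (2 : ℝ)))
    exact (by fun_prop : Continuous fun θ ↦ sin θ * log 4).add
      ((by fun_prop : Continuous fun θ : ℝ ↦ 4 * sin (θ / 2)).mul this)
  · exact continuous_sin.mul
      ((continuous_sqDist s).log fun θ ↦ (sqDist_pos_of_one_lt hs θ).ne')

lemma integral_cos_mul_log_sqDist {s : ℝ} (hs : 1 ≤ s) :
    ∫ θ in 0..π, cos θ * log (sqDist s θ) = π / s := by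
  have hs₀ : 0 < s := by linarith
  have i₁ : IntervalIntegrable (fun θ ↦ cos θ * log (sqDist s θ)) volume 0 π :=
    (intervalIntegrable_log_sqDist_zero_pi s).continuousOn_mul continuous_cos.continuousOn
  have c₂ : Continuous (fun θ ↦ (1 + s ^ 2) - 2 * s * cos θ) := by fun_prop
  have c₃ := continuous_div_sqDist hs
  have i₂ := c₂.intervalIntegrable (μ := volume) 0 π
  have i₃ := c₃.intervalIntegrable (μ := volume) 0 π
  have i₄ := (i₂.sub i₃).const_mul (1 / (2 * s))
  have key := intervalIntegral.integral_eq_sub_of_hasDerivAt_of_le pi_pos.le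
    (continuous_sin_mul_log_sqDist hs).continuousOn
    (f' := fun θ ↦ cos θ * log (sqDist s θ)
      - 1 / (2 * s) * ((1 + s ^ 2) - 2 * s * cos θ - (s ^ 2 - 1) ^ 2 / sqDist s θ))
    (fun θ hθ ↦ by
      have hX := sqDist_pos_of_mem_Ioo hs hθ
      have hd : HasDerivAt (sqDist s) (2 * s * -sin θ) θ :=
        ((hasDerivAt_cos θ).const_mul (2 * s)).const_add (1 + s ^ 2)
      refine ((hasDerivAt_sin θ).mul (hd.log hX.ne')).congr_deriv ?_
      field_simp
      unfold sqDist
      linear_combination (-4 * s ^ 2) * sin_sq_add_cos_sq θ)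
    (i₁.sub i₄)
  rw [intervalIntegral.integral_sub i₁ i₄, intervalIntegral.integral_const_mul,
    intervalIntegral.integral_sub i₂ i₃, integral_div_sqDist hs,
    intervalIntegral.integral_sub (by simp) (Continuous.intervalIntegrable (by fun_prop) _ _),
    intervalIntegral.integral_const_mul, integral_cos] at key
  simp only [sin_pi, sin_zero, intervalIntegral.integral_const, smul_eq_mul] at key
  field_simp at key ⊢
  linarith

lemma integral_log_mul_sqrt_eq {s : ℝ} (hs : 1 ≤ s) :
    ∫ x in ((1 - s) ^ 2)..((1 + s) ^ 2),
      log x * √(4 * s ^ 2 - (x - 1 - s ^ 2) ^ 2) / (2 * π * x)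
    = ∫ θ in 0..π, 1 / (2 * π) * ((1 + s ^ 2) * log (sqDist s θ)
        - 2 * s * (cos θ * log (sqDist s θ))
        - log (sqDist s θ) * ((s ^ 2 - 1) ^ 2 / sqDist s θ)) := by
  have hd (θ : ℝ) : HasDerivAt (sqDist s) (2 * s * -sin θ) θ :=
    ((hasDerivAt_cos θ).const_mul (2 * s)).const_add (1 + s ^ 2)
  have h := integral_Icc_deriv_smul_of_deriv_nonpos (f := sqDist s) (a := 0) (b := π)
    (g := fun x ↦ log x * √(4 * s ^ 2 - (x - 1 - s ^ 2) ^ 2) / (2 * π * x))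
    (continuous_sqDist s).continuousOn (fun θ _ ↦ hd θ)
    (fun θ hθ ↦ by
      have := sin_pos_of_mem_Ioo hθ
      nlinarith) pi_pos.le
  have h₀ : sqDist s 0 = (1 + s) ^ 2 := by rw [sqDist, cos_zero]; ring
  have hπ : sqDist s π = (1 - s) ^ 2 := by rw [sqDist, cos_pi]; ring
  rw [h₀, hπ, integral_Icc_eq_integral_Ioc, integral_Icc_eq_integral_Ioc,
    ← intervalIntegral.integral_of_le pi_pos.le,
    ← intervalIntegral.integral_of_le (by nlinarith)] at h
  rw [← neg_eq_iff_eq_neg] at h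
  rw [← h, ← intervalIntegral.integral_neg]
  refine intervalIntegral.integral_congr fun θ hθ ↦ ?_
  rw [Set.uIcc_of_le pi_pos.le] at hθ
  have hsin := sin_nonneg_of_mem_Icc hθ
  have hsqrt : √(4 * s ^ 2 - (sqDist s θ - 1 - s ^ 2) ^ 2) = 2 * s * sin θ := by
    rw [← sqrt_sq (by positivity : 0 ≤ 2 * s * sin θ)]
    congr 1
    unfold sqDist
    linear_combination (-4 * s ^ 2) * sin_sq_add_cos_sq θ
  simp only [hsqrt, smul_eq_mul]
  by_cases hX : sqDist s θ = 0
  · simp [hX]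
  field_simp
  have : 4 * s ^ 2 * sin θ ^ 2
      = ((1 + s ^ 2) - 2 * s * cos θ) * sqDist s θ - (s ^ 2 - 1) ^ 2 := by
    unfold sqDist
    linear_combination (4 * s ^ 2) * sin_sq_add_cos_sq θ
  linear_combination log (sqDist s θ) * this

/-- For every real `l ≥ 1`,
`∫_{(1−√l)²}^{(1+√l)²} log x · √(4l − (x−1−l)²)/(2πx) dx = l·log l − (l−1)·log(l−1) − 1`,
with the convention (automatic in Lean, where `log 0 = 0`) that `(l−1)·log(l−1) = 0` when
`l = 1`; in particular, for `l = 1` the integral equals `−1`. -/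
theorem stmt13 (l : ℝ) (hl : 1 ≤ l) :
    ∫ x in ((1 - Real.sqrt l) ^ 2)..((1 + Real.sqrt l) ^ 2),
      Real.log x * Real.sqrt (4 * l - (x - 1 - l) ^ 2) / (2 * π * x)
    = l * Real.log l - (l - 1) * Real.log (l - 1) - 1 := by
  obtain ⟨s, hs, rfl⟩ : ∃ s : ℝ, 1 ≤ s ∧ s ^ 2 = l :=
    ⟨√l, one_le_sqrt.2 hl, sq_sqrt (by linarith)⟩
  have hs₀ : 0 < s := by linarith
  have i₁ := intervalIntegrable_log_sqDist_zero_pi s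
  have i₂ : IntervalIntegrable (fun θ ↦ cos θ * log (sqDist s θ)) volume 0 π :=
    i₁.continuousOn_mul continuous_cos.continuousOn
  have i₃ := (continuous_log_mul_div_sqDist hs).intervalIntegrable (μ := volume) 0 π
  rw [sqrt_sq hs₀.le, integral_log_mul_sqrt_eq hs, intervalIntegral.integral_const_mul,
    intervalIntegral.integral_sub ((i₁.const_mul _).sub (i₂.const_mul _)) i₃,
    intervalIntegral.integral_sub (i₁.const_mul _) (i₂.const_mul _),
    intervalIntegral.integral_const_mul, intervalIntegral.integral_const_mul,
    integral_log_sqDist hs, integral_cos_mul_log_sqDist hs, integral_log_mul_div_sqDist hs,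
    log_pow]
  push_cast
  field_simp
  ring
end
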